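/- For 0 ≤ r < R, ∫₀^∞ ((R·J₁(Rt) − r·J₁(rt))/t)² dt = (4R³/(3π)) · G(r/R), where G(w) = 1 + w³ + (1−w²)K(w) − (1+w²)E(w). -/

import Mathlib

noncomputable def ellK (w : ℝ) : ℝ := ∫ θ in (0:ℝ)..(Real.pi/2), 1 / Real.sqrt (1 - w^2 * Real.sin θ ^ 2)

noncomputable def ellE (w : ℝ) : ℝ := ∫ θ in (0:ℝ)..(Real.pi/2), Real.sqrt (1 - w^2 * Real.sin θ ^ 2)

noncomputable def Gfun (w : ℝ) : ℝ := 1 + w^3 + (1 - w^2) * ellK w - (1 + w^2) * ellE w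

noncomputable def besselJ1 (x : ℝ) : ℝ := (1 / Real.pi) * ∫ θ in (0:ℝ)..Real.pi, Real.cos (θ - x * Real.sin θ)

open MeasureTheory Real

/-- Restriction of a half-disc weighted integral to its support. -/
lemma half_disc_integral (a : ℝ) (ha : 0 ≤ a) (g : ℝ → ℝ) :
    ∫ u, √(a ^ 2 - u ^ 2) * g u = ∫ u in (-a)..a, √(a ^ 2 - u ^ 2) * g u := by
  rw [intervalIntegral.integral_of_le (by linarith)]
  symm
  apply setIntegral_eq_integral_of_forall_compl_eq_zero
  intro u hu
  have : √(a ^ 2 - u ^ 2) = 0 := by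
    apply Real.sqrt_eq_zero_of_nonpos
    by_contra h
    apply hu
    have h1 : |u| < a := abs_lt_of_sq_lt_sq (by linarith) ha
    have := abs_lt.1 h1
    exact ⟨this.1, this.2.le⟩
  rw [this, zero_mul]

/-- Substitution `u = a sin θ`. -/
lemma half_disc_subst (a : ℝ) (ha : 0 ≤ a) (g : ℝ → ℝ) (hg : Continuous g) :
    ∫ u, √(a ^ 2 - u ^ 2) * g u =
      ∫ θ in (-(π / 2))..(π / 2), a ^ 2 * cos θ ^ 2 * g (a * sin θ) := by
  rw [half_disc_integral a ha g]
  have key := intervalIntegral.integral_comp_mul_deriv (a := -(π / 2)) (b := π / 2)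
    (f := fun θ => a * sin θ) (f' := fun θ => a * cos θ)
    (g := fun u => √(a ^ 2 - u ^ 2) * g u)
    (fun θ _ => (hasDerivAt_sin θ).const_mul a)
    (by fun_prop) (by fun_prop)
  simp only [sin_neg, sin_pi_div_two, mul_neg, mul_one] at key
  rw [← key]
  apply intervalIntegral.integral_congr
  intro θ hθ
  rw [Set.uIcc_of_le (by linarith [pi_pos])] at hθ
  have hc : 0 ≤ cos θ := cos_nonneg_of_mem_Icc hθ
  have : a ^ 2 - (a * sin θ) ^ 2 = (a * cos θ) ^ 2 := by
    have := sin_sq_add_cos_sq θ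
    linear_combination a ^ 2 * (-this)
  simp only [Function.comp]
  rw [this, Real.sqrt_sq (mul_nonneg ha hc)]
  ring

lemma besselJ1_eq (x : ℝ) :
    π * besselJ1 x = ∫ θ in (-(π / 2))..(π / 2), sin θ * sin (x * sin θ) := by
  have h0 : ∫ θ in (0:ℝ)..π, cos θ * cos (x * sin θ) = 0 := by
    have := intervalIntegral.integral_comp_sub_left (a := 0) (b := π)
      (fun θ => cos θ * cos (x * sin θ)) π
    simp only [cos_pi_sub, sin_pi_sub, sub_self, sub_zero, neg_mul,
      intervalIntegral.integral_neg] at this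
    linarith
  have hp : Function.Periodic (fun θ => sin θ * sin (x * sin θ)) π := by
    intro θ
    simp [sin_add_pi]
  have h1 := hp.intervalIntegral_add_eq (-(π / 2)) 0
  rw [show -(π / 2) + π = π / 2 by ring, zero_add] at h1
  rw [h1, besselJ1, ← mul_assoc, mul_one_div_cancel pi_ne_zero, one_mul]
  simp only [cos_sub]
  rw [intervalIntegral.integral_add (Continuous.intervalIntegrable (by fun_prop) _ _)
    (Continuous.intervalIntegrable (by fun_prop) _ _), h0, zero_add]

lemma half_disc_cos (a t : ℝ) (ha : 0 ≤ a) :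
    t * ∫ u, √(a ^ 2 - u ^ 2) * cos (t * u) = π * (a * besselJ1 (a * t)) := by
  rw [half_disc_subst a ha (fun u => cos (t * u)) (by fun_prop)]
  have hF : ∀ θ ∈ Set.uIcc (-(π / 2)) (π / 2),
      HasDerivAt (fun θ => a * (cos θ * sin (a * t * sin θ)))
        (t * (a ^ 2 * cos θ ^ 2 * cos (t * (a * sin θ)))
          - a * (sin θ * sin (a * t * sin θ))) θ := by
    intro θ _
    have h1 := ((hasDerivAt_sin θ).const_mul (a * t)).sin
    have h2 := ((hasDerivAt_cos θ).mul h1).const_mul a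
    refine HasDerivAt.congr_deriv h2 ?_
    rw [show t * (a * sin θ) = a * t * sin θ by ring]
    ring
  have := intervalIntegral.integral_eq_sub_of_hasDerivAt hF
    (Continuous.intervalIntegrable (by fun_prop) _ _)
  rw [intervalIntegral.integral_sub (Continuous.intervalIntegrable (by fun_prop) _ _)
    (Continuous.intervalIntegrable (by fun_prop) _ _),
    intervalIntegral.integral_const_mul, intervalIntegral.integral_const_mul,
    ← besselJ1_eq] at this
  simp only [cos_neg, cos_pi_div_two, zero_mul, mul_zero, sub_zero] at this
  linarith

lemma half_disc_sq (a : ℝ) (ha : 0 ≤ a) :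
    ∫ u, √(a ^ 2 - u ^ 2) * √(a ^ 2 - u ^ 2) = 4 * a ^ 3 / 3 := by
  rw [half_disc_integral a ha (fun u => √(a ^ 2 - u ^ 2))]
  have : ∫ u in (-a)..a, √(a ^ 2 - u ^ 2) * √(a ^ 2 - u ^ 2) = ∫ u in (-a)..a, (a ^ 2 - u ^ 2) := by
    apply intervalIntegral.integral_congr
    intro u hu
    rw [Set.uIcc_of_le (by linarith)] at hu
    apply Real.mul_self_sqrt
    nlinarith [hu.1, hu.2]
  rw [this, intervalIntegral.integral_sub (by simp) (Continuous.intervalIntegrable (by fun_prop) _ _)]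
  simp
  ring

lemma elliptic_identity (w : ℝ) (hw : 0 ≤ w) (hw1 : w < 1) :
    3 * w ^ 2 * ∫ θ in (0:ℝ)..(π / 2), cos θ ^ 2 * √(1 - w ^ 2 * sin θ ^ 2) =
      (1 + w ^ 2) * ellE w - (1 - w ^ 2) * ellK w := by
  have hpos : ∀ θ : ℝ, 0 < 1 - w ^ 2 * sin θ ^ 2 := by
    intro θ
    have := sin_sq_le_one θ
    have h2 : w ^ 2 < 1 := by nlinarith
    nlinarith [sq_nonneg w, sq_nonneg (sin θ)]
  have hne : ∀ θ : ℝ, √(1 - w ^ 2 * sin θ ^ 2) ≠ 0 := fun θ => (Real.sqrt_pos.2 (hpos θ)).ne'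
  have hF : ∀ θ ∈ Set.uIcc (0:ℝ) (π / 2),
      HasDerivAt (fun θ => w ^ 2 * (sin θ * cos θ * √(1 - w ^ 2 * sin θ ^ 2)))
        (3 * w ^ 2 * (cos θ ^ 2 * √(1 - w ^ 2 * sin θ ^ 2))
          - (1 + w ^ 2) * √(1 - w ^ 2 * sin θ ^ 2)
          + (1 - w ^ 2) * (1 / √(1 - w ^ 2 * sin θ ^ 2))) θ := by
    intro θ _
    have h1 := ((((hasDerivAt_sin θ).pow 2).const_mul (w ^ 2)).const_sub 1).sqrt (hpos θ).ne'
    have h2 := ((((hasDerivAt_sin θ).mul (hasDerivAt_cos θ)).mul h1).const_mul (w ^ 2))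
    refine HasDerivAt.congr_deriv h2 ?_
    have hs := Real.sq_sqrt (hpos θ).le
    have hn := hne θ
    have hc : cos θ ^ 2 = 1 - sin θ ^ 2 := by linarith [sin_sq_add_cos_sq θ]
    simp only [Pi.mul_apply, Pi.pow_apply]
    set D := √(1 - w ^ 2 * sin θ ^ 2) with hD
    field_simp
    simp only [hs, hc]
    push_cast
    ring_nf
    try simp only [hs, hc]
    try ring
  have hc1 : Continuous fun θ => 1 / √(1 - w ^ 2 * sin θ ^ 2) :=
    continuous_const.div (by fun_prop) hne
  have := intervalIntegral.integral_eq_sub_of_hasDerivAt hF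
    (Continuous.intervalIntegrable (by fun_prop) _ _)
  rw [intervalIntegral.integral_add (Continuous.intervalIntegrable (by fun_prop) _ _)
    (Continuous.intervalIntegrable (by fun_prop) _ _),
    intervalIntegral.integral_sub (Continuous.intervalIntegrable (by fun_prop) _ _)
    (Continuous.intervalIntegrable (by fun_prop) _ _),
    intervalIntegral.integral_const_mul, intervalIntegral.integral_const_mul,
    intervalIntegral.integral_const_mul] at this
  simp only [cos_pi_div_two, sin_zero, zero_mul, mul_zero, sub_zero] at this
  simp only [ellE, ellK]
  linarith

lemma half_disc_cross (r R : ℝ) (hr : 0 ≤ r) (hrR : r < R) :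
    ∫ u, √(r ^ 2 - u ^ 2) * √(R ^ 2 - u ^ 2) =
      2 * R ^ 3 / 3 * ((1 + (r / R) ^ 2) * ellE (r / R) - (1 - (r / R) ^ 2) * ellK (r / R)) := by
  have hR : 0 < R := by linarith
  rw [half_disc_subst r hr (fun u => √(R ^ 2 - u ^ 2)) (by fun_prop),
    ← elliptic_identity (r / R) (by positivity) ((div_lt_one hR).2 hrR)]
  set g : ℝ → ℝ := fun θ => cos θ ^ 2 * √(1 - (r / R) ^ 2 * sin θ ^ 2) with hg
  have h1 : ∀ θ, r ^ 2 * cos θ ^ 2 * √(R ^ 2 - (r * sin θ) ^ 2) = (r ^ 2 * R) * g θ := by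
    intro θ
    have : R ^ 2 - (r * sin θ) ^ 2 = R ^ 2 * (1 - (r / R) ^ 2 * sin θ ^ 2) := by
      field_simp
    rw [this, Real.sqrt_mul (by positivity), Real.sqrt_sq hR.le]
    simp only [hg]; ring
  simp only [h1]
  rw [intervalIntegral.integral_const_mul]
  have hgc : Continuous g := by fun_prop
  have h2 : ∫ θ in (-(π / 2))..(π / 2), g θ = 2 * ∫ θ in (0:ℝ)..(π / 2), g θ := by
    rw [← intervalIntegral.integral_add_adjacent_intervals (b := 0)
      (hgc.intervalIntegrable _ _) (hgc.intervalIntegrable _ _)]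
    have := intervalIntegral.integral_comp_neg (a := 0) (b := π / 2) g
    rw [neg_zero] at this
    rw [← this]
    have : ∀ θ, g (-θ) = g θ := by intro θ; simp [hg]
    simp only [this]
    ring
  rw [h2]
  field_simp

/-- The even, compactly supported function whose Fourier transform appears in the integral. -/
noncomputable def phiDisc (r R u : ℝ) : ℝ := √(R ^ 2 - u ^ 2) - √(r ^ 2 - u ^ 2)

lemma half_disc_hasCompactSupport (a : ℝ) : HasCompactSupport (fun u : ℝ => √(a ^ 2 - u ^ 2)) := by
  apply HasCompactSupport.intro (isCompact_Icc (a := -|a|) (b := |a|))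
  intro u hu
  apply Real.sqrt_eq_zero_of_nonpos
  by_contra h
  apply hu
  have h1 : |u| < |a| := sq_lt_sq.1 (by linarith)
  have := abs_lt.1 h1
  exact ⟨this.1.le, this.2.le⟩

lemma half_disc_integrable (a : ℝ) (g : ℝ → ℝ) (hg : Continuous g) :
    Integrable (fun u : ℝ => √(a ^ 2 - u ^ 2) * g u) :=
  Continuous.integrable_of_hasCompactSupport (by fun_prop)
    ((half_disc_hasCompactSupport a).mul_right)

lemma phiDisc_continuous (r R : ℝ) : Continuous (phiDisc r R) := by
  unfold phiDisc; fun_prop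

lemma phiDisc_hasCompactSupport (r R : ℝ) : HasCompactSupport (phiDisc r R) :=
  (half_disc_hasCompactSupport R).sub (half_disc_hasCompactSupport r)

lemma phiDisc_cos (r R t : ℝ) (hr : 0 ≤ r) (hrR : r < R) :
    t * ∫ u, phiDisc r R u * cos (t * u) =
      π * (R * besselJ1 (R * t) - r * besselJ1 (r * t)) := by
  simp only [phiDisc, sub_mul]
  rw [integral_sub (half_disc_integrable R _ (by fun_prop))
    (half_disc_integrable r _ (by fun_prop)), mul_sub, half_disc_cos R t (by linarith),
    half_disc_cos r t hr]
  ring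

lemma phiDisc_sq (r R : ℝ) (hr : 0 ≤ r) (hrR : r < R) :
    ∫ u, phiDisc r R u ^ 2 = 4 * R ^ 3 / 3 * Gfun (r / R) := by
  have : ∀ u, phiDisc r R u ^ 2 = √(R ^ 2 - u ^ 2) * √(R ^ 2 - u ^ 2)
      + √(r ^ 2 - u ^ 2) * √(r ^ 2 - u ^ 2) - 2 * (√(r ^ 2 - u ^ 2) * √(R ^ 2 - u ^ 2)) := by
    intro u; unfold phiDisc; ring
  have i1 := half_disc_integrable R (fun u => √(R ^ 2 - u ^ 2)) (by fun_prop)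
  have i2 := half_disc_integrable r (fun u => √(r ^ 2 - u ^ 2)) (by fun_prop)
  have i3 := half_disc_integrable r (fun u => √(R ^ 2 - u ^ 2)) (by fun_prop)
  simp only [this]
  have i12 : Integrable (fun u => √(R ^ 2 - u ^ 2) * √(R ^ 2 - u ^ 2)
      + √(r ^ 2 - u ^ 2) * √(r ^ 2 - u ^ 2)) := i1.add i2
  rw [integral_sub i12 (i3.const_mul 2), integral_add i1 i2, integral_const_mul,
    half_disc_sq R (by linarith), half_disc_sq r hr, half_disc_cross r R hr hrR, Gfun]
  have hR : R ≠ 0 := by linarith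
  field_simp
  ring

lemma besselJ1_abs_le (x : ℝ) : |besselJ1 x| ≤ 1 := by
  have h := intervalIntegral.norm_integral_le_of_norm_le_const (a := 0) (b := π) (C := 1)
    (f := fun θ => cos (θ - x * sin θ)) (fun θ _ => abs_cos_le_one _)
  rw [besselJ1, abs_mul, abs_of_pos (by positivity)]
  rw [Real.norm_eq_abs, sub_zero, abs_of_pos pi_pos, one_mul] at h
  calc 1 / π * |∫ θ in (0:ℝ)..π, cos (θ - x * sin θ)| ≤ 1 / π * π := by gcongr
    _ = 1 := by field_simp

/-- Parseval identity for a real, even, continuous function with compact support whose cosine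
transform is `O(1/t)`. -/
lemma parseval_even (φ : ℝ → ℝ) (hc : Continuous φ) (hs : HasCompactSupport φ)
    (he : ∀ u, φ (-u) = φ u) (C : ℝ)
    (hC : ∀ t, |t * ∫ u, φ u * cos (t * u)| ≤ C) :
    ∫ t in Set.Ioi (0:ℝ), (∫ u, φ u * cos (t * u)) ^ 2 = π * ∫ u, φ u ^ 2 := by
  have hi : Integrable φ := hc.integrable_of_hasCompactSupport hs
  set P : ℝ → ℝ := fun t => ∫ u, φ u * cos (t * u) with hP
  set f : ℝ → ℂ := fun u => (φ u : ℂ) with hf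
  have hfc : Continuous f := by fun_prop
  have hfs : HasCompactSupport f := hs.comp_left (g := fun x : ℝ => (x : ℂ)) (by simp)
  have hfi : Integrable f := hi.ofReal
  have hFt : ∀ ξ, FourierTransform.fourier f ξ = (P (2 * π * ξ) : ℂ) := by
    intro ξ
    rw [Real.fourier_real_eq_integral_exp_smul]
    have hodd : ∫ u, φ u * sin (2 * π * ξ * u) = 0 := by
      have := integral_neg_eq_self (fun u => φ u * sin (2 * π * ξ * u)) volume
      simp only [he, mul_neg, sin_neg, integral_neg] at this
      linarith
    have e1 : ∀ u : ℝ, Complex.exp (↑(-2 * π * u * ξ) * Complex.I) • f u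
        = ((φ u * cos (2 * π * ξ * u) : ℝ) : ℂ) - ((φ u * sin (2 * π * ξ * u) : ℝ) : ℂ) * Complex.I := by
      intro u
      rw [Complex.exp_mul_I, ← Complex.ofReal_cos, ← Complex.ofReal_sin,
        show -2 * π * u * ξ = -(2 * π * ξ * u) by ring, cos_neg, sin_neg]
      simp only [hf, smul_eq_mul]
      push_cast
      ring
    have i1 : Integrable (fun u => φ u * cos (2 * π * ξ * u)) :=
      Continuous.integrable_of_hasCompactSupport (by fun_prop) hs.mul_right
    have i2 : Integrable (fun u => φ u * sin (2 * π * ξ * u)) :=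
      Continuous.integrable_of_hasCompactSupport (by fun_prop) hs.mul_right
    simp only [e1]
    rw [integral_sub i1.ofReal (i2.ofReal.mul_const _), integral_mul_const, integral_complex_ofReal,
      integral_complex_ofReal, hodd]
    simp [hP]
  have hFcont : Continuous (FourierTransform.fourier f) :=
    VectorFourier.fourierIntegral_continuous Real.continuous_fourierChar (by fun_prop) hfi
  have hPc : Continuous (fun ξ => P (2 * π * ξ)) := by
    have : (fun ξ => P (2 * π * ξ)) = fun ξ => (FourierTransform.fourier f ξ).re := by
      funext ξ; rw [hFt]; simp
    rw [this]
    exact Complex.continuous_re.comp hFcont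
  set Q : ℝ → ℝ := fun ξ => P (2 * π * ξ) with hQ
  have hQi : Integrable (fun ξ => Q ξ ^ 2) := by
    set M := ∫ u, |φ u|
    have hM : ∀ t, |P t| ≤ M := by
      intro t
      refine (norm_integral_le_integral_norm (fun u => φ u * cos (t * u))).trans ?_
      apply integral_mono_of_nonneg (Filter.Eventually.of_forall fun u => norm_nonneg _) hi.abs
      refine Filter.Eventually.of_forall fun u => ?_
      simp only [norm_mul, Real.norm_eq_abs]
      exact mul_le_of_le_one_right (abs_nonneg _) (abs_cos_le_one _)
    refine (integrable_inv_one_add_sq.const_mul (M ^ 2 + C ^ 2)).mono'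
      (hPc.pow 2).aestronglyMeasurable (Filter.Eventually.of_forall fun ξ => ?_)
    have h1 := hM (2 * π * ξ)
    have h2 := hC (2 * π * ξ)
    have h1' : Q ξ ^ 2 ≤ M ^ 2 := sq_le_sq' (abs_le.1 h1).1 (abs_le.1 h1).2
    have h2' : (2 * π * ξ * Q ξ) ^ 2 ≤ C ^ 2 := sq_le_sq' (abs_le.1 h2).1 (abs_le.1 h2).2
    rw [Real.norm_eq_abs, abs_of_nonneg (sq_nonneg _), ← div_eq_mul_inv, le_div_iff₀ (by positivity)]
    have h3 : (ξ * Q ξ) ^ 2 ≤ (2 * π * ξ * Q ξ) ^ 2 := by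
      have : (1:ℝ) ≤ (2 * π) ^ 2 := by nlinarith [pi_gt_three]
      nlinarith [sq_nonneg (ξ * Q ξ)]
    nlinarith
  have hconv : ∀ ξ, FourierTransform.fourier (convolution f f (ContinuousLinearMap.mul ℂ ℂ) volume) ξ
      = ((Q ξ ^ 2 : ℝ) : ℂ) := by
    intro ξ
    rw [Real.fourier_mul_convolution_eq hfi hfi, hFt]
    push_cast; ring
  have hconv' := funext hconv
  have hcc : Continuous (convolution f f (ContinuousLinearMap.mul ℂ ℂ) volume) :=
    hfs.continuous_convolution_right _ hfi.locallyIntegrable hfc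
  have hinv := hcc.fourierInv_fourier_eq (hfi.integrable_convolution _ hfi)
    (by rw [hconv']; exact hQi.ofReal)
  have h0 := congrFun hinv 0
  rw [hconv', Real.fourierInv_eq] at h0
  simp only [inner_zero_right, AddChar.map_zero_eq_one, one_smul, integral_complex_ofReal] at h0
  have h1 : convolution f f (ContinuousLinearMap.mul ℂ ℂ) volume 0 = ((∫ u, φ u ^ 2 : ℝ) : ℂ) := by
    rw [convolution, ← integral_complex_ofReal]
    congr 1
    funext u
    simp only [ContinuousLinearMap.mul_apply', zero_sub, hf, he]
    push_cast; ring
  rw [h1] at h0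
  have h2 : ∫ ξ, Q ξ ^ 2 = ∫ u, φ u ^ 2 := by exact_mod_cast h0
  rw [← h2]
  have h3 := Measure.integral_comp_mul_left (fun t => P t ^ 2) (2 * π)
  have h4 : ∫ t, P t ^ 2 = 2 * ∫ t in Set.Ioi (0:ℝ), P t ^ 2 := by
    rw [← integral_comp_abs (f := fun t => P t ^ 2)]
    congr 1
    funext t
    rcases abs_choice t with h | h
    · rw [h]
    · rw [h]; simp [hP]
  simp only [hQ]
  rw [h3, h4, abs_of_pos (by positivity), smul_eq_mul]
  field_simp
  rfl

theorem J1_diff_square_integral (r R : ℝ) (hr : 0 ≤ r) (hrR : r < R) :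
    ∫ t in Set.Ioi (0:ℝ), ((R * besselJ1 (R * t) - r * besselJ1 (r * t)) / t) ^ 2 =
      (4 * R ^ 3 / (3 * Real.pi)) * Gfun (r / R) := by
  have hp := parseval_even (phiDisc r R) (phiDisc_continuous r R) (phiDisc_hasCompactSupport r R)
    (by intro u; simp [phiDisc]) (π * (R + r)) (by
      intro t
      rw [phiDisc_cos r R t hr hrR, abs_mul, abs_of_pos pi_pos]
      have h1 := abs_le.1 (besselJ1_abs_le (R * t))
      have h2 := abs_le.1 (besselJ1_abs_le (r * t))
      apply mul_le_mul_of_nonneg_left _ pi_pos.le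
      rw [abs_le]
      constructor <;> nlinarith)
  rw [phiDisc_sq r R hr hrR] at hp
  have h1 : ∫ t in Set.Ioi (0:ℝ), (∫ u, phiDisc r R u * cos (t * u)) ^ 2 =
      ∫ t in Set.Ioi (0:ℝ), π ^ 2 *
        ((R * besselJ1 (R * t) - r * besselJ1 (r * t)) / t) ^ 2 := by
    apply setIntegral_congr_fun measurableSet_Ioi
    intro t ht
    have ht' : t ≠ 0 := (Set.mem_Ioi.1 ht).ne'
    have := phiDisc_cos r R t hr hrR
    have h2 : ∫ u, phiDisc r R u * cos (t * u) =
        π * ((R * besselJ1 (R * t) - r * besselJ1 (r * t)) / t) := by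
      rw [← mul_div_assoc, ← this]; field_simp
    simp only [h2]
    ring
  rw [h1, integral_const_mul] at hp
  have hpi := pi_ne_zero
  apply mul_left_cancel₀ (pow_ne_zero 2 hpi)
  rw [hp]
  field_simp
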